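/- The proof system ELCR^- is sound for the class of k-sight models: every L^--formula provable in ELCR^- is valid on k-sight models (true at every situation of every k-sight model), and the two rules (K-Additivity) and (K-Elimination) preserve validity. -/

import Mathlib

/-! Core definitions for the Epistemic Logic of Cops and Robbers (ELCR). -/

/-- The two players/variables. -/
inductive Var : Type
  | x | y
  deriving DecidableEq

/-- The other variable. -/
def Var.other : Var → Var
  | .x => .y
  | .y => .x

/-- Terms: constants or variables. -/
inductive Term (Cons : Type) : Type
  | const (c : Cons)
  | var (v : Var)
  deriving DecidableEq

/-- Formulas of the full language `L` (with movement modalities). -/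
inductive Form (Pred Cons : Type) : Type
  | pred (P : Pred) (args : List (Term Cons))
  | rel (t₁ t₂ : Term Cons)
  | eq (t₁ t₂ : Term Cons)
  | neg (φ : Form Pred Cons)
  | and (φ ψ : Form Pred Cons)
  | Kt (z : Var) (t : Term Cons)
  | K (z : Var) (φ : Form Pred Cons)
  | box (z : Var) (φ : Form Pred Cons)

namespace Form

variable {Pred Cons : Type}

def imp (φ ψ : Form Pred Cons) : Form Pred Cons := .neg (.and φ (.neg ψ))
def or (φ ψ : Form Pred Cons) : Form Pred Cons := .neg (.and (.neg φ) (.neg ψ))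
def iffF (φ ψ : Form Pred Cons) : Form Pred Cons := .and (imp φ ψ) (imp ψ φ)
def falseF : Form Pred Cons := .neg (.eq (.var .x) (.var .x))
def trueF : Form Pred Cons := .neg falseF
/-- `⟨K_z⟩φ := ¬K_z¬φ`. -/
def diaK (z : Var) (φ : Form Pred Cons) : Form Pred Cons := .neg (.K z (.neg φ))

def bigAnd : List (Form Pred Cons) → Form Pred Cons
  | [] => trueF
  | φ :: l => .and φ (bigAnd l)

def bigOr : List (Form Pred Cons) → Form Pred Cons
  | [] => falseF
  | φ :: l => or φ (bigOr l)

/-- Membership in the Boolean base language `L_B`. -/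
def isBase : Form Pred Cons → Prop
  | .pred _ _ => True
  | .rel _ _ => True
  | .eq _ _ => True
  | .neg φ => isBase φ
  | .and φ ψ => isBase φ ∧ isBase ψ
  | .Kt _ _ => False
  | .K _ _ => False
  | .box _ _ => False

/-- Membership in `L_BD` (Booleans plus movement modalities). -/
def isBD : Form Pred Cons → Prop
  | .pred _ _ => True
  | .rel _ _ => True
  | .eq _ _ => True
  | .neg φ => isBD φ
  | .and φ ψ => isBD φ ∧ isBD ψ
  | .Kt _ _ => False
  | .K _ _ => False
  | .box _ φ => isBD φ

/-- Membership in the full language `L`. -/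
def isL : Form Pred Cons → Prop
  | .pred _ _ => True
  | .rel _ _ => True
  | .eq _ _ => True
  | .neg φ => isL φ
  | .and φ ψ => isL φ ∧ isL ψ
  | .Kt _ _ => True
  | .K _ ψ => isBD ψ
  | .box _ φ => isL φ

/-- Membership in the static fragment `L⁻`: no movement modalities, and the
knowledge operator `K_z` is applied to `L_B`-formulas only. -/
def isStatic : Form Pred Cons → Prop
  | .pred _ _ => True
  | .rel _ _ => True
  | .eq _ _ => True
  | .neg φ => isStatic φ
  | .and φ ψ => isStatic φ ∧ isStatic ψ
  | .Kt _ _ => True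
  | .K _ φ => isBase φ
  | .box _ _ => False

/-- The variable `z` occurs in the formula. -/
def occurs (z : Var) : Form Pred Cons → Prop
  | .pred _ args => Term.var z ∈ args
  | .rel t₁ t₂ => t₁ = Term.var z ∨ t₂ = Term.var z
  | .eq t₁ t₂ => t₁ = Term.var z ∨ t₂ = Term.var z
  | .neg φ => occurs z φ
  | .and φ ψ => occurs z φ ∨ occurs z ψ
  | .Kt w t => w = z ∨ t = Term.var z
  | .K w φ => w = z ∨ occurs z φ
  | .box w φ => w = z ∨ occurs z φ

/-- The list of terms occurring in a formula. -/
def termList : Form Pred Cons → List (Term Cons)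
  | .pred _ args => args
  | .rel t₁ t₂ => [t₁, t₂]
  | .eq t₁ t₂ => [t₁, t₂]
  | .neg φ => termList φ
  | .and φ ψ => termList φ ++ termList ψ
  | .Kt _ t => [t]
  | .K _ φ => termList φ
  | .box _ φ => termList φ

end Form

/-- Substituting the constant `c` for the variable `z` in a term. -/
def Term.substC {Cons : Type} (c : Cons) (z : Var) : Term Cons → Term Cons
  | .var v => if v = z then .const c else .var v
  | .const c' => .const c'

/-- `φ.substC c z` is `φ[c/z]`. -/
def Form.substC {Pred Cons : Type} (c : Cons) (z : Var) : Form Pred Cons → Form Pred Cons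
  | .pred P args => .pred P (args.map (Term.substC c z))
  | .rel t₁ t₂ => .rel (t₁.substC c z) (t₂.substC c z)
  | .eq t₁ t₂ => .eq (t₁.substC c z) (t₂.substC c z)
  | .neg φ => .neg (φ.substC c z)
  | .and φ ψ => .and (φ.substC c z) (ψ.substC c z)
  | .Kt w t => .Kt w (t.substC c z)
  | .K w φ => .K w (φ.substC c z)
  | .box w φ => .box w (φ.substC c z)

/-- Replacing the term `t₂` by the term `t₁`. -/
def Term.repl {Cons : Type} [DecidableEq Cons] (t₁ t₂ t : Term Cons) : Term Cons :=
  if t = t₂ then t₁ else t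

/-- `φ.replace t₁ t₂` is `φ[t₁/t₂]`: the result of replacing `t₂` in `φ` with `t₁`. -/
def Form.replace {Pred Cons : Type} [DecidableEq Cons] (t₁ t₂ : Term Cons) :
    Form Pred Cons → Form Pred Cons
  | .pred P args => .pred P (args.map (Term.repl t₁ t₂))
  | .rel s₁ s₂ => .rel (Term.repl t₁ t₂ s₁) (Term.repl t₁ t₂ s₂)
  | .eq s₁ s₂ => .eq (Term.repl t₁ t₂ s₁) (Term.repl t₁ t₂ s₂)
  | .neg φ => .neg (φ.replace t₁ t₂)
  | .and φ ψ => .and (φ.replace t₁ t₂) (ψ.replace t₁ t₂)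
  | .Kt w t => .Kt w (Term.repl t₁ t₂ t)
  | .K w φ => .K w (φ.replace t₁ t₂)
  | .box w φ => .box w (φ.replace t₁ t₂)

/-- The list of all terms (constants and variables), for finite `Cons`. -/
noncomputable def allTerms (Cons : Type) [Fintype Cons] : List (Term Cons) :=
  (Finset.univ : Finset Cons).toList.map Term.const ++ [Term.var .x, Term.var .y]

/-- The syntactic distance formulas `D^n t₁ t₂`. -/
noncomputable def distForm (Pred : Type) {Cons : Type} [Fintype Cons] :
    ℕ → Term Cons → Term Cons → Form Pred Cons
  | 0, t₁, t₂ => .eq t₁ t₂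
  | n + 1, t₁, t₂ =>
      Form.or (distForm Pred n t₁ t₂)
        (Form.bigOr ((allTerms Cons).map fun t =>
          Form.and (distForm Pred n t₁ t) (Form.or (.rel t t₂) (.rel t₂ t))))

/-- `K_z z' = T`: the set `T` consists of the possible positions of `z'` considered by `z`. -/
noncomputable def KzEqSet {Pred Cons : Type} [Fintype Cons] [DecidableEq Cons]
    (z z' : Var) (T : Finset Cons) : Form Pred Cons :=
  Form.bigAnd
    ((T.toList.map fun c => Form.diaK z (.eq (.var z') (.const c))) ++
      (Tᶜ.toList.map fun c => Form.K z (.neg (.eq (.var z') (.const c)))))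

/-- `Rz = T`: `T` is exactly the set of (names of) R-successors of `z`. -/
noncomputable def RzEqSet {Pred Cons : Type} [Fintype Cons] [DecidableEq Cons]
    (z : Var) (T : Finset Cons) : Form Pred Cons :=
  Form.bigAnd
    ((T.toList.map fun c => Form.rel (.var z) (.const c)) ++
      (Tᶜ.toList.map fun c => Form.neg (Form.rel (.var z) (.const c))))

/-- The list of all subsets of `Cons`. -/
noncomputable def powList (Cons : Type) [Fintype Cons] [DecidableEq Cons] : List (Finset Cons) :=
  (Finset.univ : Finset Cons).powerset.toList

/-! ### Semantics -/

/-- An interpretation of the vocabulary over a domain `D`. -/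
structure Interp (Pred Cons D : Type) where
  pred : Pred → List D → Prop
  rel : D → D → Prop
  const : Cons → D

/-- Assignments (situations): positions of the two players. -/
abbrev Assign (D : Type) := Var → D

/-- The value of a term at an interpretation and a situation. -/
def Term.val {Pred Cons D : Type} (I : Interp Pred Cons D) (σ : Assign D) :
    Term Cons → D
  | .const c => I.const c
  | .var v => σ v

/-- `Dball I m s` is `D^m(s)`: points reachable from `s` in at most `m` steps
along `I.rel` or its converse. -/
def Dball {Pred Cons D : Type} (I : Interp Pred Cons D) : ℕ → D → Set D
  | 0, s => {s}
  | m + 1, s => Dball I m s ∪ {t | ∃ u ∈ Dball I m s, I.rel u t ∨ I.rel t u}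

/-- `R^z σ σ'`: player `z` moves along an arrow, the other player stays put. -/
def Rstep {Pred Cons D : Type} (I : Interp Pred Cons D) (z : Var) (σ σ' : Assign D) : Prop :=
  I.rel (σ z) (σ' z) ∧ σ z.other = σ' z.other

/-- Indistinguishability data: a relation on assignments for each player. -/
abbrev SimRel (D : Type) := Var → Assign D → Assign D → Prop

/-- `Σ|σ`: the situations related to `σ` by some player's indistinguishability. -/
def restrict {D : Type} (Sit : Set (Assign D)) (sim : SimRel D) (σ : Assign D) :
    Set (Assign D) :=
  {σ' ∈ Sit | ∃ z, sim z σ σ'}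

/-- The updated set of situations after player `z` moves from `σ₁` to `σ₂`. -/
def updSit {Pred Cons D : Type} (k : ℕ) (I : Interp Pred Cons D)
    (Sit : Set (Assign D)) (sim : SimRel D) (z : Var) (σ₁ σ₂ : Assign D) :
    Set (Assign D) :=
  {σ' | (σ₂ Var.x ∈ Dball I k (σ₂ Var.y) ∧ σ' = σ₂) ∨
        (σ₂ Var.x ∉ Dball I k (σ₂ Var.y) ∧
          (∃ σ ∈ restrict Sit sim σ₁, Rstep I z σ σ') ∧
          σ' Var.x ∉ Dball I k (σ' Var.y))}

/-- The updated indistinguishability relations: `σ₁ ∼'_z σ₂` iff `σ₁ z = σ₂ z`. -/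
def updSim (D : Type) : SimRel D := fun z σ₁ σ₂ => σ₁ z = σ₂ z

/-- Satisfaction for `ELCR` (with sight `k`). -/
def Sat {Pred Cons D : Type} (k : ℕ) (I : Interp Pred Cons D) :
    Set (Assign D) → SimRel D → Assign D → Form Pred Cons → Prop
  | _, _, σ, .pred P args => I.pred P (args.map (Term.val I σ))
  | _, _, σ, .rel t₁ t₂ => I.rel (t₁.val I σ) (t₂.val I σ)
  | _, _, σ, .eq t₁ t₂ => t₁.val I σ = t₂.val I σ
  | Sit, sim, σ, .neg φ => ¬ Sat k I Sit sim σ φ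
  | Sit, sim, σ, .and φ ψ => Sat k I Sit sim σ φ ∧ Sat k I Sit sim σ ψ
  | Sit, sim, σ, .Kt z t => ∀ σ' ∈ Sit, sim z σ' σ → t.val I σ = t.val I σ'
  | Sit, sim, σ, .K z φ => ∀ σ' ∈ Sit, sim z σ' σ → Sat k I Sit sim σ' φ
  | Sit, sim, σ, .box z φ => ∀ σ₂, Rstep I z σ σ₂ →
      Sat k I (updSit k I Sit sim z σ σ₂) (updSim D) σ₂ φ

/-- The conditions making `(D, I, Σ, ∼)` a model: seriality of `I.rel`, every
point named by a constant, `Σ` nonempty, and each `∼_z` an equivalence relation on `Σ`. -/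
structure IsModel {Pred Cons D : Type} (I : Interp Pred Cons D)
    (Sit : Set (Assign D)) (sim : SimRel D) : Prop where
  serial : ∀ s, ∃ t, I.rel s t
  const_surj : Function.Surjective I.const
  nonempty : Sit.Nonempty
  sim_mem : ∀ z σ σ', sim z σ σ' → σ ∈ Sit ∧ σ' ∈ Sit
  sim_refl : ∀ z, ∀ σ ∈ Sit, sim z σ σ
  sim_symm : ∀ z σ σ', sim z σ σ' → sim z σ' σ
  sim_trans : ∀ z σ₁ σ₂ σ₃, sim z σ₁ σ₂ → sim z σ₂ σ₃ → sim z σ₁ σ₃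

/-- The `k`-sight condition. -/
def KSight {Pred Cons D : Type} (k : ℕ) (I : Interp Pred Cons D)
    (Sit : Set (Assign D)) (sim : SimRel D) : Prop :=
  ∀ z σ σ', σ ∈ Sit → σ' ∈ Sit → sim z σ σ' →
    ∀ z', σ z' ∈ Dball I k (σ z) → σ z' = σ' z'

/-- A nonempty conjunction `K_zα₁ ∧ ⋯ ∧ K_zαₙ ∧ ⟨K_z⟩β₁ ∧ ⋯ ∧ ⟨K_z⟩βₘ`. -/
def kConj {Pred Cons : Type} (z : Var) (αs βs : List (Form Pred Cons)) :
    Form Pred Cons :=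
  Form.bigAnd (αs.map (Form.K z) ++ βs.map (Form.diaK z))
/-! ### The proof system ELCR⁻ -/

/-- Evaluation of a formula under a propositional valuation of its non-Boolean
components: used to define propositional tautologies. -/
def Form.evalProp {Pred Cons : Type} (v : Form Pred Cons → Prop) :
    Form Pred Cons → Prop
  | .neg φ => ¬ Form.evalProp v φ
  | .and φ ψ => Form.evalProp v φ ∧ Form.evalProp v ψ
  | φ => v φ

/-- Propositional tautologies. -/
def Form.Tautology {Pred Cons : Type} (φ : Form Pred Cons) : Prop :=
  ∀ v : Form Pred Cons → Prop, Form.evalProp v φ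

/-- The Hilbert-style proof system `ELCR⁻` for the static fragment, with sight `k`. -/
inductive Prov {Pred Cons : Type} [Fintype Cons] [DecidableEq Cons] (k : ℕ) :
    Form Pred Cons → Prop
  | taut {φ : Form Pred Cons} : φ.isStatic → φ.Tautology → Prov k φ
  | mp {φ ψ : Form Pred Cons} : Prov k (φ.imp ψ) → Prov k φ → Prov k ψ
  | eqRefl (t : Term Cons) : Prov k (.eq t t)
  | eqSymm (t₁ t₂ : Term Cons) : Prov k ((Form.eq t₁ t₂).imp (.eq t₂ t₁))
  | eqTrans (t₁ t₂ t₃ : Term Cons) :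
      Prov k (((Form.eq t₁ t₂).and (.eq t₂ t₃)).imp (.eq t₁ t₃))
  | eqSubst {α : Form Pred Cons} (t₁ t₂ : Term Cons) : α.isBase →
      Prov k ((Form.eq t₁ t₂).imp (α.iffF (α.replace t₁ t₂)))
  | seriality (c : Cons) :
      Prov k (Form.bigOr ((Finset.univ : Finset Cons).toList.map fun t =>
        Form.rel (.const c) (.const t)))
  | atSomewhere (z : Var) :
      Prov k (Form.bigOr ((Finset.univ : Finset Cons).toList.map fun c =>
        Form.eq (.var z) (.const c)))
  | ksight (z : Var) (t : Term Cons) :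
      Prov k ((distForm Pred k (.var z) t).imp (.Kt z t))
  | kAx {α β : Form Pred Cons} (z : Var) : α.isBase → β.isBase →
      Prov k ((Form.K z (α.imp β)).imp ((Form.K z α).imp (.K z β)))
  | tAx {α : Form Pred Cons} (z : Var) : α.isBase →
      Prov k ((Form.K z α).imp α)
  | kGround {α : Form Pred Cons} (z : Var) (T : Finset Cons) : α.isBase →
      Prov k ((KzEqSet z z.other T).imp
        ((Form.K z α).iffF (Form.bigAnd (T.toList.map fun c => α.substC c z.other))))
  | kAdd {α : Form Pred Cons} (z : Var) (αs βs : List (Form Pred Cons)) :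
      α.isBase → (∀ γ ∈ αs, γ.isBase) → (∀ γ ∈ βs, γ.isBase) →
      1 ≤ αs.length + βs.length →
      Prov k ((kConj z αs βs).imp α) → Prov k ((kConj z αs βs).imp (.K z α))
  | kElim {α β : Form Pred Cons} (z : Var) (αs βs : List (Form Pred Cons)) :
      α.isBase → β.isBase → (∀ γ ∈ αs, γ.isBase) → (∀ γ ∈ βs, γ.isBase) →
      1 ≤ αs.length + βs.length →
      Prov k ((kConj z.other αs βs).imp ((Form.K z α).imp β)) →
      Prov k ((kConj z.other αs βs).imp (α.imp β))
  | deRe (z : Var) (t : Term Cons) (c : Cons) :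
      Prov k ((Form.eq t (.const c)).imp
        ((Form.Kt z t).iffF (.K z (.eq t (.const c)))))
  | structK {α : Form Pred Cons} (z : Var) (T : Finset (Term Cons)) : α.isBase →
      (∀ t ∈ α.termList, t ∈ T) →
      Prov k (((Form.bigAnd (T.toList.map (Form.Kt z))).and α).imp (.K z α))

/-- A set of formulas is consistent if no finite conjunction from it proves `⊥`. -/
def consistentS {Pred Cons : Type} [Fintype Cons] [DecidableEq Cons] (k : ℕ)
    (Γ : Set (Form Pred Cons)) : Prop :=
  ¬ ∃ l : List (Form Pred Cons), (∀ φ ∈ l, φ ∈ Γ) ∧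
      Prov k ((Form.bigAnd l).imp Form.falseF)

/-- Maximally consistent sets of `L⁻`-formulas. -/
def MCS {Pred Cons : Type} [Fintype Cons] [DecidableEq Cons] (k : ℕ)
    (Δ : Set (Form Pred Cons)) : Prop :=
  consistentS k Δ ∧ (∀ φ ∈ Δ, Form.isStatic φ) ∧
    ∀ φ : Form Pred Cons, φ.isStatic → φ ∈ Δ ∨ Form.neg φ ∈ Δ

/-- All terms of the formula are constants. -/
def isConsOnly {Pred Cons : Type} (φ : Form Pred Cons) : Prop :=
  ∀ t ∈ φ.termList, ∃ c : Cons, t = Term.const c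

/-- `Δ₁ =^Cons Δ₂`: the two sets contain the same `L_B`-formulas whose terms are
all constants. -/
def consEq {Pred Cons : Type} (Δ₁ Δ₂ : Set (Form Pred Cons)) : Prop :=
  ∀ α : Form Pred Cons, α.isBase → isConsOnly α → (α ∈ Δ₁ ↔ α ∈ Δ₂)
/-- Validity on `k`-sight models. -/
def ValidK {Pred Cons : Type} (k : ℕ) (φ : Form Pred Cons) : Prop :=
  ∀ (D : Type), Finite D →
    ∀ (I : Interp Pred Cons D) (Sit : Set (Assign D)) (sim : SimRel D),
      IsModel I Sit sim → KSight k I Sit sim →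
        ∀ σ ∈ Sit, Sat k I Sit sim σ φ

section Semantics

variable {Pred Cons D : Type} {k : ℕ} {I : Interp Pred Cons D} {Sit Sit' : Set (Assign D)}
  {sim sim' : SimRel D} {σ σ' : Assign D}

@[simp]
theorem sat_imp {φ ψ : Form Pred Cons} :
    Sat k I Sit sim σ (φ.imp ψ) ↔ (Sat k I Sit sim σ φ → Sat k I Sit sim σ ψ) := by
  simp [Form.imp, Sat]

@[simp]
theorem sat_or {φ ψ : Form Pred Cons} :
    Sat k I Sit sim σ (φ.or ψ) ↔ (Sat k I Sit sim σ φ ∨ Sat k I Sit sim σ ψ) := by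
  simp only [Form.or, Sat]
  tauto

@[simp]
theorem sat_iffF {φ ψ : Form Pred Cons} :
    Sat k I Sit sim σ (φ.iffF ψ) ↔ (Sat k I Sit sim σ φ ↔ Sat k I Sit sim σ ψ) := by
  simp only [Form.iffF, Sat, sat_imp]
  tauto

@[simp]
theorem sat_diaK {z : Var} {φ : Form Pred Cons} :
    Sat k I Sit sim σ (.diaK z φ) ↔ ∃ σ' ∈ Sit, sim z σ' σ ∧ Sat k I Sit sim σ' φ := by
  simp [Form.diaK, Sat]

@[simp]
theorem sat_bigAnd {l : List (Form Pred Cons)} :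
    Sat k I Sit sim σ (.bigAnd l) ↔ ∀ φ ∈ l, Sat k I Sit sim σ φ := by
  induction l with
  | nil => simp [Form.bigAnd, Form.trueF, Form.falseF, Sat]
  | cons φ l ih => simp [Form.bigAnd, Sat, ih]

@[simp]
theorem sat_bigOr {l : List (Form Pred Cons)} :
    Sat k I Sit sim σ (.bigOr l) ↔ ∃ φ ∈ l, Sat k I Sit sim σ φ := by
  induction l with
  | nil => simp [Form.bigOr, Form.falseF, Sat]
  | cons φ l ih => simp [Form.bigOr, ih]

theorem sat_kConj {z : Var} {αs βs : List (Form Pred Cons)} :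
    Sat k I Sit sim σ (kConj z αs βs) ↔
      (∀ α ∈ αs, Sat k I Sit sim σ (.K z α)) ∧ ∀ β ∈ βs, Sat k I Sit sim σ (.diaK z β) := by
  simp only [kConj, sat_bigAnd, List.mem_append, List.mem_map]
  constructor
  · exact fun h => ⟨fun α hα => h _ (.inl ⟨α, hα, rfl⟩), fun β hβ => h _ (.inr ⟨β, hβ, rfl⟩)⟩
  · rintro ⟨hα, hβ⟩ _ (⟨γ, hγ, rfl⟩ | ⟨γ, hγ, rfl⟩)
    exacts [hα γ hγ, hβ γ hγ]

theorem sat_KzEqSet [Fintype Cons] [DecidableEq Cons] {z z' : Var} {T : Finset Cons} :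
    Sat k I Sit sim σ (KzEqSet z z' T) ↔
      (∀ c ∈ T, ∃ σ' ∈ Sit, sim z σ' σ ∧ σ' z' = I.const c) ∧
        ∀ c ∉ T, ∀ σ' ∈ Sit, sim z σ' σ → σ' z' ≠ I.const c := by
  simp only [KzEqSet, sat_bigAnd, List.mem_append, List.mem_map, Finset.mem_toList,
    Finset.mem_compl]
  constructor
  · intro h
    refine ⟨fun c hc => ?_, fun c hc => ?_⟩
    · simpa [Sat, Term.val] using h _ (.inl ⟨c, hc, rfl⟩)
    · simpa [Sat, Term.val] using h _ (.inr ⟨c, hc, rfl⟩)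
  · rintro ⟨h, h'⟩ _ (⟨c, hc, rfl⟩ | ⟨c, hc, rfl⟩)
    · simpa [Sat, Term.val] using h c hc
    · simpa [Sat, Term.val] using h' c hc

/-- The truth value of a base formula depends only on the values of its terms. -/
theorem sat_congr_of_isBase {α : Form Pred Cons} (hα : α.isBase)
    (h : ∀ t ∈ α.termList, t.val I σ = t.val I σ') :
    Sat k I Sit sim σ α ↔ Sat k I Sit' sim' σ' α := by
  induction α with
  | pred P args =>
    have hargs : args.map (Term.val I σ) = args.map (Term.val I σ') := List.map_congr_left h
    simp only [Sat, hargs]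
  | rel t₁ t₂ | eq t₁ t₂ => simp_all [Sat, Form.termList]
  | neg φ ih => exact not_congr (ih hα h)
  | and φ ψ ihφ ihψ =>
    exact and_congr (ihφ hα.1 fun t ht => h t (List.mem_append_left _ ht))
      (ihψ hα.2 fun t ht => h t (List.mem_append_right _ ht))
  | Kt | K | box => exact hα.elim

theorem val_repl [DecidableEq Cons] {t₁ t₂ : Term Cons} (h : t₁.val I σ = t₂.val I σ)
    (t : Term Cons) : (Term.repl t₁ t₂ t).val I σ = t.val I σ := by
  unfold Term.repl
  split_ifs with ht
  exacts [ht ▸ h, rfl]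

theorem sat_replace [DecidableEq Cons] {α : Form Pred Cons} (hα : α.isBase) {t₁ t₂ : Term Cons}
    (h : t₁.val I σ = t₂.val I σ) :
    Sat k I Sit sim σ (α.replace t₁ t₂) ↔ Sat k I Sit sim σ α := by
  induction α with
  | pred P args =>
    have hcomp : Term.val I σ ∘ Term.repl t₁ t₂ = Term.val I σ := funext (val_repl h)
    simp only [Form.replace, Sat, List.map_map, hcomp]
  | rel | eq => simp only [Form.replace, Sat, val_repl h]
  | neg φ ih => exact not_congr (ih hα)
  | and φ ψ ihφ ihψ => exact and_congr (ihφ hα.1) (ihψ hα.2)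
  | Kt | K | box => exact hα.elim

theorem val_substC {c : Cons} {z : Var} (hc : σ' z = I.const c)
    (h : ∀ v ≠ z, σ v = σ' v) (t : Term Cons) :
    (t.substC c z).val I σ = t.val I σ' := by
  cases t with
  | const => rfl
  | var v =>
    by_cases hv : v = z
    · simp [Term.substC, Term.val, hv, hc]
    · simp [Term.substC, Term.val, hv, h v hv]

theorem sat_substC {α : Form Pred Cons} (hα : α.isBase) {c : Cons} {z : Var}
    (hc : σ' z = I.const c) (h : ∀ v ≠ z, σ v = σ' v) :
    Sat k I Sit sim σ (α.substC c z) ↔ Sat k I Sit sim σ' α := by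
  induction α with
  | pred P args =>
    have hcomp : Term.val I σ ∘ Term.substC c z = Term.val I σ' := funext (val_substC hc h)
    simp only [Form.substC, Sat, List.map_map, hcomp]
  | rel | eq => simp only [Form.substC, Sat, val_substC hc h]
  | neg φ ih => exact not_congr (ih hα)
  | and φ ψ ihφ ihψ => exact and_congr (ihφ hα.1) (ihψ hα.2)
  | Kt | K | box => exact hα.elim

theorem evalProp_sat (φ : Form Pred Cons) :
    Form.evalProp (Sat k I Sit sim σ) φ ↔ Sat k I Sit sim σ φ := by
  induction φ with
  | neg φ ih => exact not_congr ih
  | and φ ψ ihφ ihψ => exact and_congr ihφ ihψ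
  | pred | rel | eq | Kt | K | box => rfl

theorem mem_Dball_of_sat_distForm [Fintype Cons] {n : ℕ} {t₁ t₂ : Term Cons}
    (h : Sat k I Sit sim σ (distForm Pred n t₁ t₂)) :
    t₂.val I σ ∈ Dball I n (t₁.val I σ) := by
  induction n generalizing t₂ with
  | zero => exact h.symm
  | succ n ih =>
    rw [distForm, sat_or, sat_bigOr] at h
    obtain h | ⟨_, hφ, h⟩ := h
    · exact .inl (ih h)
    · obtain ⟨t, -, rfl⟩ := List.mem_map.1 hφ
      exact .inr ⟨t.val I σ, ih h.1, sat_or.1 h.2⟩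

theorem self_mem_Dball (n : ℕ) (s : D) : s ∈ Dball I n s := by
  induction n with
  | zero => rfl
  | succ n ih => exact .inl ih

/-- Indistinguishable situations agree on the position of the observing player. -/
theorem KSight.eq_self (hk : KSight k I Sit sim) (hM : IsModel I Sit sim) {z : Var}
    (h : sim z σ σ') : σ z = σ' z :=
  hk z σ σ' (hM.sim_mem _ _ _ h).1 (hM.sim_mem _ _ _ h).2 h z (self_mem_Dball _ _)

theorem sat_K_of_sim (hM : IsModel I Sit sim) {z : Var} (h : sim z σ σ') {α : Form Pred Cons}
    (hα : Sat k I Sit sim σ (.K z α)) : Sat k I Sit sim σ' (.K z α) :=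
  fun _ hτ hτσ => hα _ hτ (hM.sim_trans _ _ _ _ hτσ (hM.sim_symm _ _ _ h))

theorem sat_kConj_of_sim (hM : IsModel I Sit sim) {z : Var} (h : sim z σ σ')
    {αs βs : List (Form Pred Cons)} (hc : Sat k I Sit sim σ (kConj z αs βs)) :
    Sat k I Sit sim σ' (kConj z αs βs) := by
  rw [sat_kConj] at hc ⊢
  exact ⟨fun α hα => sat_K_of_sim hM h (hc.1 α hα),
    fun β hβ hK => hc.2 β hβ (sat_K_of_sim hM (hM.sim_symm _ _ _ h) hK)⟩

theorem sat_kGround [Fintype Cons] [DecidableEq Cons] (hM : IsModel I Sit sim)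
    (hk : KSight k I Sit sim) {α : Form Pred Cons} (hα : α.isBase) {z : Var} {T : Finset Cons}
    (hT : Sat k I Sit sim σ (KzEqSet z z.other T)) :
    Sat k I Sit sim σ (.K z α) ↔
      ∀ c ∈ T, Sat k I Sit sim σ (α.substC c z.other) := by
  rw [sat_KzEqSet] at hT
  have agree : ∀ τ, sim z τ σ → ∀ v ≠ z.other, σ v = τ v := by
    intro τ hτ v hv
    obtain rfl : v = z := by cases v <;> cases z <;> simp_all [Var.other]
    exact (hk.eq_self hM hτ).symm
  constructor
  · intro hK c hc
    obtain ⟨τ, hτ, hsim, hval⟩ := hT.1 c hc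
    exact (sat_substC hα hval (agree τ hsim)).2 (hK τ hτ hsim)
  · intro h τ hτ hsim
    obtain ⟨c, hc⟩ := hM.const_surj (τ z.other)
    have hcT : c ∈ T := by
      by_contra hcT
      exact hT.2 c hcT τ hτ hsim hc.symm
    exact (sat_substC hα hc.symm (agree τ hsim)).1 (h c hcT)

theorem Var.other_ne (z : Var) : z.other ≠ z := by
  cases z <;> simp [Var.other]

/-- The knowledge of player `w` depends only on the relation `sim w`. -/
theorem sat_kConj_congr {w : Var} (hw : sim w = sim' w) {αs βs : List (Form Pred Cons)}
    (hαs : ∀ γ ∈ αs, γ.isBase) (hβs : ∀ γ ∈ βs, γ.isBase) :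
    Sat k I Sit sim σ (kConj w αs βs) ↔ Sat k I Sit sim' σ (kConj w αs βs) := by
  have base : ∀ {γ : Form Pred Cons}, γ.isBase → ∀ τ,
      (Sat k I Sit sim τ γ ↔ Sat k I Sit sim' τ γ) :=
    fun hγ _ => sat_congr_of_isBase hγ fun _ _ => rfl
  simp only [sat_kConj, sat_diaK, Sat, hw]
  refine and_congr (forall₂_congr fun γ hγ => ?_) (forall₂_congr fun γ hγ => ?_)
  · simp only [base (hαs γ hγ)]
  · simp only [base (hβs γ hγ)]

/-- The indistinguishability data in which player `z` distinguishes all situations. -/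
def omniscient (Sit : Set (Assign D)) (sim : SimRel D) (z : Var) : SimRel D :=
  Function.update sim z fun σ σ' => σ ∈ Sit ∧ σ = σ'

theorem IsModel.omniscient (hM : IsModel I Sit sim) (z : Var) :
    IsModel I Sit (omniscient Sit sim z) where
  serial := hM.serial
  const_surj := hM.const_surj
  nonempty := hM.nonempty
  sim_mem w σ σ' := by
    by_cases hw : w = z
    · subst hw
      simpa [_root_.omniscient] using fun h h' => h' ▸ ⟨h, h⟩
    · simpa [_root_.omniscient, hw] using hM.sim_mem w σ σ'
  sim_refl w σ := by
    by_cases hw : w = z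
    · subst hw
      simp [_root_.omniscient]
    · simpa [_root_.omniscient, hw] using hM.sim_refl w σ
  sim_symm w σ σ' := by
    by_cases hw : w = z
    · subst hw
      simpa [_root_.omniscient] using fun h h' => ⟨h' ▸ h, h'.symm⟩
    · simpa [_root_.omniscient, hw] using hM.sim_symm w σ σ'
  sim_trans w σ₁ σ₂ σ₃ := by
    by_cases hw : w = z
    · subst hw
      simpa [_root_.omniscient] using fun h h' _ h'' => ⟨h, h'.trans h''⟩
    · simpa [_root_.omniscient, hw] using hM.sim_trans w σ₁ σ₂ σ₃

theorem KSight.omniscient (hk : KSight k I Sit sim) (z : Var) :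
    KSight k I Sit (omniscient Sit sim z) := by
  intro w σ σ' hσ hσ' h v hv
  by_cases hw : w = z
  · subst hw
    simp only [_root_.omniscient, Function.update_self] at h
    rw [h.2]
  · simp only [_root_.omniscient, Function.update_of_ne hw] at h
    exact hk w σ σ' hσ hσ' h v hv

end Semantics

section Rules

variable {Pred Cons : Type} {k : ℕ}

theorem ValidK.kAdd {z : Var} {α : Form Pred Cons} {αs βs : List (Form Pred Cons)}
    (h : ValidK k ((kConj z αs βs).imp α)) : ValidK k ((kConj z αs βs).imp (.K z α)) := by
  intro D hD I Sit sim hM hk σ _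
  rw [sat_imp]
  intro hc τ hτ hsim
  exact sat_imp.1 (h D hD I Sit sim hM hk τ hτ)
    (sat_kConj_of_sim hM (hM.sim_symm _ _ _ hsim) hc)

theorem ValidK.kElim {z : Var} {α β : Form Pred Cons} {αs βs : List (Form Pred Cons)}
    (hα : α.isBase) (hβ : β.isBase) (hαs : ∀ γ ∈ αs, γ.isBase) (hβs : ∀ γ ∈ βs, γ.isBase)
    (h : ValidK k ((kConj z.other αs βs).imp ((Form.K z α).imp β))) :
    ValidK k ((kConj z.other αs βs).imp (α.imp β)) := by
  intro D hD I Sit sim hM hk σ hσ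
  have h := h D hD I Sit _ (hM.omniscient z) (hk.omniscient z) σ hσ
  rw [sat_imp, sat_imp] at h ⊢
  intro hc hσα
  have hw : sim z.other = omniscient Sit sim z z.other := by
    simp [omniscient, Var.other_ne]
  refine (sat_congr_of_isBase hβ fun _ _ => rfl).1
    (h ((sat_kConj_congr hw hαs hβs).1 hc) fun τ _ hτσ => ?_)
  simp only [omniscient, Function.update_self] at hτσ
  exact (sat_congr_of_isBase hα fun _ _ => by rw [hτσ.2]).1 hσα

theorem Prov.valid [Fintype Cons] [DecidableEq Cons] {φ : Form Pred Cons} (h : Prov k φ) :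
    ValidK k φ := by
  induction h with
  | taut _ hφ => exact fun D hD I Sit sim hM hk σ hσ => (evalProp_sat _).1 (hφ _)
  | mp _ _ ih₁ ih₂ =>
    exact fun D hD I Sit sim hM hk σ hσ =>
      sat_imp.1 (ih₁ D hD I Sit sim hM hk σ hσ) (ih₂ D hD I Sit sim hM hk σ hσ)
  | kAdd z αs βs _ _ _ _ _ ih => exact ih.kAdd
  | kElim z αs βs hα hβ hαs hβs _ _ ih => exact ih.kElim hα hβ hαs hβs
  | eqRefl t => exact fun D hD I Sit sim hM hk σ hσ => rfl
  | eqSymm t₁ t₂ => exact fun D hD I Sit sim hM hk σ hσ => sat_imp.2 Eq.symm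
  | eqTrans t₁ t₂ t₃ =>
    exact fun D hD I Sit sim hM hk σ hσ => sat_imp.2 fun h => Eq.trans h.1 h.2
  | eqSubst t₁ t₂ hα =>
    exact fun D hD I Sit sim hM hk σ hσ =>
      sat_imp.2 fun h => sat_iffF.2 (sat_replace hα h).symm
  | seriality c =>
    intro D hD I Sit sim hM hk σ hσ
    obtain ⟨d, hd⟩ := hM.serial (I.const c)
    obtain ⟨t, rfl⟩ := hM.const_surj d
    simpa [Sat, Term.val] using ⟨t, hd⟩
  | atSomewhere z =>
    intro D hD I Sit sim hM hk σ hσ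
    obtain ⟨c, hc⟩ := hM.const_surj (σ z)
    simpa [Sat, Term.val] using ⟨c, hc.symm⟩
  | ksight z t =>
    intro D hD I Sit sim hM hk σ hσ
    rw [sat_imp]
    intro h τ hτ hsim
    cases t with
    | const c => rfl
    | var v =>
      exact hk z σ τ hσ hτ (hM.sim_symm _ _ _ hsim) v (mem_Dball_of_sat_distForm h)
  | kAx z _ _ =>
    intro D hD I Sit sim hM hk σ hσ
    rw [sat_imp, sat_imp]
    exact fun h h' τ hτ hsim => sat_imp.1 (h τ hτ hsim) (h' τ hτ hsim)
  | tAx z _ =>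
    exact fun D hD I Sit sim hM hk σ hσ =>
      sat_imp.2 fun h => h σ hσ (hM.sim_refl z σ hσ)
  | kGround z T hα =>
    intro D hD I Sit sim hM hk σ hσ
    rw [sat_imp, sat_iffF]
    intro hT
    simpa using sat_kGround hM hk hα hT
  | deRe z t c =>
    intro D hD I Sit sim hM hk σ hσ
    rw [sat_imp, sat_iffF]
    intro h
    simp only [Sat] at h ⊢
    refine forall₃_congr fun τ _ _ => ?_
    rw [h]
    exact eq_comm
  | structK z T hα hT =>
    intro D hD I Sit sim hM hk σ hσ
    rw [sat_imp]
    rintro ⟨hK, hσα⟩ τ hτ hsim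
    rw [sat_bigAnd] at hK
    refine (sat_congr_of_isBase hα fun t ht => ?_).1 hσα
    exact hK _ (List.mem_map_of_mem (Finset.mem_toList.2 (hT t ht))) τ hτ hsim

end Rules

/-- Soundness of `ELCR⁻` for `k`-sight models, and validity
preservation for the rules (K-Additivity) and (K-Elimination). -/
theorem elcr_minus_sound {Pred Cons : Type} [Fintype Cons] [DecidableEq Cons]
    [Nonempty Cons] (k : ℕ) :
    (∀ φ : Form Pred Cons, Prov k φ → ValidK k φ) ∧
    (∀ (z : Var) (α : Form Pred Cons) (αs βs : List (Form Pred Cons)),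
      α.isBase → (∀ γ ∈ αs, γ.isBase) → (∀ γ ∈ βs, γ.isBase) →
      1 ≤ αs.length + βs.length →
      ValidK k ((kConj z αs βs).imp α) →
      ValidK k ((kConj z αs βs).imp (Form.K z α))) ∧
    (∀ (z : Var) (α β : Form Pred Cons) (αs βs : List (Form Pred Cons)),
      α.isBase → β.isBase → (∀ γ ∈ αs, γ.isBase) → (∀ γ ∈ βs, γ.isBase) →
      1 ≤ αs.length + βs.length →
      ValidK k ((kConj z.other αs βs).imp ((Form.K z α).imp β)) →
      ValidK k ((kConj z.other αs βs).imp (α.imp β))) :=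
  ⟨fun _ h => h.valid, fun _ _ _ _ _ _ _ _ h => h.kAdd,
    fun _ _ _ _ _ hα hβ hαs hβs _ h => h.kElim hα hβ hαs hβs⟩
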